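/- arXiv:2310.17859 — 3 statements merged into one kernel-verified Lean document; each statement's English description precedes it below -/
import Mathlib

section
/- Let a, b, k, n be positive integers with n ≥ max{a+k, b+k}. Let A and B be subsets of [n] with |A| = a and |B| = b, and let Ka and Kb be the k-partners of A and B respectively. If A ≺ B, then Kb ≺ Ka. In particular, if a ≤ b and A is the a-parity of B, then Kb = Ka. -/
open Finset

attribute [local instance] Classical.propDecidable

noncomputable section

/-- The ground set `[n] = {1, …, n}`. -/
def ground (n : ℕ) : Finset ℕ := Finset.Icc 1 n

/-- `C([n], k)`: the family of all `k`-element subsets of `[n]`. -/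
def ksubsets (n k : ℕ) : Finset (Finset ℕ) := Finset.powersetCard k (ground n)

/-- Two families are cross intersecting. -/
def CrossInt (A B : Finset (Finset ℕ)) : Prop :=
  ∀ a ∈ A, ∀ b ∈ B, (a ∩ b).Nonempty

/-- The lexicographic order `A ≺ B`:  `A ⊇ B` or `min (A ∖ B) < min (B ∖ A)`. -/
def lex (A B : Finset ℕ) : Prop :=
  B ⊆ A ∨ (A \ B).min < (B \ A).min

/-- Strict lexicographic order `A ⪵ B`. -/
def lexLT (A B : Finset ℕ) : Prop := lex A B ∧ A ≠ B

/-- `L(R, k)` over `[n]`: all `k`-subsets of `[n]` that are `≺ R`. -/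
def Lset (n : ℕ) (R : Finset ℕ) (k : ℕ) : Finset (Finset ℕ) :=
  (ksubsets n k).filter fun F => lex F R

/-- `L(r, k)`: the first `r` elements of `C([n], k)` in lexicographic order. -/
def Lnum (n r k : ℕ) : Finset (Finset ℕ) :=
  (ksubsets n k).filter fun F => ((ksubsets n k).filter fun G => lex G F).card ≤ r

/-- A family is L-initial if it equals `L(R, k)` for some `k`-set `R` (an ID of the family). -/
def LInitial (n k : ℕ) (A : Finset (Finset ℕ)) : Prop :=
  ∃ R ∈ ksubsets n k, A = Lset n R k

/-- `F` and `H` strongly intersect at their last element; `H` is the partner of `F`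
(and `F` is the partner of `H`). -/
def IsPartner (F H : Finset ℕ) : Prop :=
  ∃ q, F ∩ H = {q} ∧ F ∪ H = Finset.Icc 1 q

/-- `K` is the `k`-partner of `F` (inside `[n]`). -/
def IsKPartner (n k : ℕ) (F K : Finset ℕ) : Prop :=
  ∃ H, IsPartner F H ∧
    ((k = H.card ∧ K = H) ∨
     (H.card < k ∧ K = H ∪ Finset.Icc (n - k + H.card + 1) n) ∨
     (k < H.card ∧ K ∈ ksubsets n k ∧ lex K H ∧
        ∀ K' ∈ ksubsets n k, lex K' H → lex K' K))

/-- `ℓ(F)`: the largest `x` with `{n - x + 1, …, n} ⊆ F` (and `0` if there is none). -/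
def ell (n : ℕ) (F : Finset ℕ) : ℕ :=
  ((Finset.range (n + 1)).filter fun x => Finset.Icc (n - x + 1) n ⊆ F).sup id

/-- `F^t = {n - ℓ(F) + 1, …, n}` (which is `∅` when `ℓ(F) = 0`). -/
def tailPart (n : ℕ) (F : Finset ℕ) : Finset ℕ := Finset.Icc (n - ell n F + 1) n

/-- Maximal cross intersecting families. -/
def MaximalCross (n f g : ℕ) (F G : Finset (Finset ℕ)) : Prop :=
  F ⊆ ksubsets n f ∧ G ⊆ ksubsets n g ∧ CrossInt F G ∧
    ∀ F' G' : Finset (Finset ℕ), F ⊆ F' → F' ⊆ ksubsets n f →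
      G ⊆ G' → G' ⊆ ksubsets n g → CrossInt F' G' → F = F' ∧ G = G'

/-- The pair of sets `(F, G)` is maximal. -/
def PairMaximal (n : ℕ) (F G : Finset ℕ) : Prop :=
  MaximalCross n F.card G.card (Lset n F F.card) (Lset n G G.card)

/-- Maximal pair families. -/
def MaximalPairFamilies (n : ℕ) (A1 A2 : Finset (Finset ℕ)) : Prop :=
  A1.card = A2.card ∧ ∀ a1 ∈ A1, ∃! a2, a2 ∈ A2 ∧ PairMaximal n a1 a2

/-- `H1` is the `|H1|`-parity of `H2` (intended for `|H1| ≤ |H2|`):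
`H1 ∖ H1^t = H2 ∖ H2^t` and `ℓ(H2) - ℓ(H1) = |H2| - |H1|`. -/
def IsParity (n : ℕ) (H1 H2 : Finset ℕ) : Prop :=
  H1 \ tailPart n H1 = H2 \ tailPart n H2 ∧
    ell n H2 + H1.card = ell n H1 + H2.card

/-- The family `H1` of `h1`-sets is the `h1`-parity of the family `H2` of `h2`-sets. -/
def FamParity (n h1 h2 : ℕ) (H1 H2 : Finset (Finset ℕ)) : Prop :=
  (∀ A ∈ H1, ∃ B ∈ ksubsets n h2, IsParity n A B ∧ B ∈ H2) ∧
  (∀ B ∈ H2, ∀ A ∈ ksubsets n h1, IsParity n A B → A ∈ H1)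

/-- An `(n, k 0, …, k (t-1))`-cross intersecting system:  non-empty pairwise
cross intersecting families `F i ⊆ C([n], k i)`. -/
def IsCIS (n : ℕ) {t : ℕ} (k : Fin t → ℕ) (F : Fin t → Finset (Finset ℕ)) : Prop :=
  (∀ i, F i ⊆ ksubsets n (k i)) ∧ (∀ i, (F i).Nonempty) ∧
    ∀ i j : Fin t, i < j → CrossInt (F i) (F j)

/-- An extremal cross intersecting system. -/
def Extremal (n : ℕ) {t : ℕ} (k : Fin t → ℕ) (F : Fin t → Finset (Finset ℕ)) : Prop :=
  IsCIS n k F ∧ ∀ G : Fin t → Finset (Finset ℕ), IsCIS n k G →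
    ∑ i, (G i).card ≤ ∑ i, (F i).card

/-- Two systems of families are isomorphic via a permutation of the ground set `[n]`. -/
def IsoSystems (n : ℕ) {t : ℕ} (F G : Fin t → Finset (Finset ℕ)) : Prop :=
  ∃ σ : Equiv.Perm ℕ, (∀ x ∈ ground n, σ x ∈ ground n) ∧
    ∀ i, F i = (G i).image fun s => s.image ⇑σ

/-- The family `ℛ₂`. -/
def R2fam (n k2 kt : ℕ) : Finset (Finset ℕ) :=
  (ksubsets n k2).filter fun R =>
    lex (insert 1 (Finset.Icc (n - k2 + 2) n)) R ∧
    lex R (insert kt (Finset.Icc (n - k2 + 2) n))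

/-- The family `ℱ₂,₃`. -/
def F23 (n k2 k3 kt : ℕ) : Finset (Finset ℕ) :=
  (R2fam n k2 kt).filter fun A => ∃ B ∈ ksubsets n k3, PairMaximal n A B

/-- `A` strictly precedes `B`: the first element where `A` and `B` differ lies in `A`. -/
def FirstDiffIn (A B : Finset ℕ) : Prop :=
  ∃ x, x ∈ A ∧ x ∉ B ∧ ∀ y < x, (y ∈ A ↔ y ∈ B)

lemma FirstDiffIn.trans {A B C : Finset ℕ} (hAB : FirstDiffIn A B) (hBC : FirstDiffIn B C) :
    FirstDiffIn A C := by
  obtain ⟨x, hxA, hxB, hx⟩ := hAB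
  obtain ⟨z, hzB, hzC, hz⟩ := hBC
  rcases lt_trichotomy x z with h | rfl | h
  · exact ⟨x, hxA, fun hxC => hxB ((hz x h).2 hxC), fun y hy =>
      (hx y hy).trans (hz y (hy.trans h))⟩
  · exact absurd hzB hxB
  · exact ⟨z, (hx z h).2 hzB, hzC, fun y hy => (hx y (hy.trans h)).trans (hz y hy)⟩

lemma not_firstDiffIn_self (A : Finset ℕ) : ¬ FirstDiffIn A A := fun ⟨_, h, h', _⟩ => h' h

lemma firstDiffIn_trichotomy (A B : Finset ℕ) : A = B ∨ FirstDiffIn A B ∨ FirstDiffIn B A := by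
  by_cases h : ∃ x, ¬ (x ∈ A ↔ x ∈ B)
  · right
    have hx := Nat.find_spec h
    have hmin : ∀ y < Nat.find h, (y ∈ A ↔ y ∈ B) := fun y hy =>
      not_not.1 (Nat.find_min h hy)
    by_cases hA : Nat.find h ∈ A
    · exact .inl ⟨_, hA, fun hB => hx (iff_of_true hA hB), hmin⟩
    · exact .inr ⟨_, by tauto, hA, fun y hy => (hmin y hy).symm⟩
  · left
    ext x
    exact not_not.1 fun hx => h ⟨x, hx⟩

lemma lex_iff_forall (A B : Finset ℕ) : lex A B ↔ ∀ x ∈ B \ A, ∃ y ∈ A \ B, y < x := by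
  constructor
  · rintro (h | h) x hx
    · simp only [mem_sdiff] at hx
      exact absurd (h hx.1) hx.2
    · have hne : (A \ B).Nonempty := by
        rw [nonempty_iff_ne_empty]
        intro h0
        simp [h0] at h
      refine ⟨(A \ B).min' hne, min'_mem _ _, ?_⟩
      have := h.trans_le (min_le hx)
      rw [← coe_min' hne] at this
      exact_mod_cast this
  · intro h
    by_cases hne : (B \ A).Nonempty
    · right
      obtain ⟨y, hy, hlt⟩ := h _ (min'_mem _ hne)
      rw [← coe_min' hne]
      exact (min_le hy).trans_lt (by exact_mod_cast hlt)
    · left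
      rwa [not_nonempty_iff_eq_empty, sdiff_eq_empty_iff_subset] at hne

lemma lex_iff_not_firstDiffIn (A B : Finset ℕ) : lex A B ↔ ¬ FirstDiffIn B A := by
  rw [lex_iff_forall]
  constructor
  · rintro h ⟨x, hxB, hxA, hx⟩
    obtain ⟨y, hy, hlt⟩ := h x (mem_sdiff.2 ⟨hxB, hxA⟩)
    rw [mem_sdiff] at hy
    exact hy.2 ((hx y hlt).2 hy.1)
  · intro h x hx
    rw [mem_sdiff] at hx
    rcases firstDiffIn_trichotomy A B with rfl | ⟨y, hyA, hyB, hy⟩ | h'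
    · exact absurd hx.1 hx.2
    · refine ⟨y, mem_sdiff.2 ⟨hyA, hyB⟩, ?_⟩
      by_contra! hle
      rcases hle.lt_or_eq with hlt | rfl
      · exact hx.2 ((hy x hlt).2 hx.1)
      · exact hx.2 hyA
    · exact absurd h' h

lemma lex_iff_eq_or_firstDiffIn (A B : Finset ℕ) : lex A B ↔ A = B ∨ FirstDiffIn A B := by
  rw [lex_iff_not_firstDiffIn]
  constructor
  · intro h
    rcases firstDiffIn_trichotomy A B with h' | h' | h'
    · exact .inl h'
    · exact .inr h'
    · exact absurd h' h
  · rintro (rfl | h) h'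
    · exact not_firstDiffIn_self _ h'
    · exact not_firstDiffIn_self _ (h.trans h')

lemma lex_refl (A : Finset ℕ) : lex A A := .inl subset_rfl

lemma lex_trans {A B C : Finset ℕ} (hAB : lex A B) (hBC : lex B C) : lex A C := by
  rw [lex_iff_eq_or_firstDiffIn] at *
  rcases hAB with rfl | hAB
  · exact hBC
  · rcases hBC with rfl | hBC
    · exact .inr hAB
    · exact .inr (hAB.trans hBC)

lemma lex_antisymm {A B : Finset ℕ} (hAB : lex A B) (hBA : lex B A) : A = B :=
  ((lex_iff_eq_or_firstDiffIn A B).1 hAB).resolve_right ((lex_iff_not_firstDiffIn B A).1 hBA)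

/-- A set precedes the partner of `A` exactly when `A` strictly precedes its complement. -/
lemma IsPartner.lex_iff {n : ℕ} {A H K : Finset ℕ} (hA : A ⊆ ground n) (hK : K ⊆ ground n)
    (hH : IsPartner A H) : lex K H ↔ FirstDiffIn A (ground n \ K) := by
  obtain ⟨q, hinter, hunion⟩ := hH
  have hi : ∀ x, (x ∈ A ∧ x ∈ H ↔ x = q) := fun x => by
    rw [← mem_inter, hinter, mem_singleton]
  have hu : ∀ x, (x ∈ A ∨ x ∈ H ↔ 1 ≤ x ∧ x ≤ q) := fun x => by
    rw [← mem_union, hunion, mem_Icc]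
  have hA' : ∀ x ∈ A, 1 ≤ x ∧ x ≤ n := fun x hx => mem_Icc.1 (hA hx)
  have hK' : ∀ x ∈ K, 1 ≤ x ∧ x ≤ n := fun x hx => mem_Icc.1 (hK hx)
  have hq := (hi q).2 rfl
  have hqn := hA' q hq.1
  have hmem : ∀ x, x ∈ ground n \ K ↔ (1 ≤ x ∧ x ≤ n) ∧ x ∉ K := fun x => by
    rw [mem_sdiff, ground, mem_Icc]
  rw [lex_iff_eq_or_firstDiffIn]
  constructor
  · intro h
    by_cases hlow : ∃ x < q, x ∈ K ∧ x ∉ H ∧ ∀ y < x, (y ∈ K ↔ y ∈ H)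
    · obtain ⟨x, hxq, hxK, hxH, hx⟩ := hlow
      refine ⟨x, ?_, ?_, fun y hy => ?_⟩ <;> grind
    · have hagree : ∀ y ≤ q, (y ∈ K ↔ y ∈ H) := by
        rcases h with rfl | ⟨x, hxK, hxH, hx⟩
        · simp
        · grind
      refine ⟨q, hq.1, ?_, fun y hy => ?_⟩ <;> grind
  · rintro ⟨x, hxA, hxK, hx⟩
    have hxK : x ∈ K := by grind
    have hxq : x ≤ q := ((hu x).1 (.inl hxA)).2
    have hagree : ∀ y < x, (y ∈ K ↔ y ∈ H) := by
      intro y hy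
      by_cases hy1 : 1 ≤ y <;> grind
    rcases hxq.lt_or_eq with hlt | rfl
    · exact .inr ⟨x, hxK, by grind, hagree⟩
    · rw [← lex_iff_eq_or_firstDiffIn]
      left
      intro y hy
      have := (hu y).1 (.inr hy)
      rcases this.2.lt_or_eq with h | rfl
      · exact (hagree y h).2 hy
      · exact hxK

lemma IsPartner.exists_last {A H : Finset ℕ} (hH : IsPartner A H) :
    ∃ q ∈ A, A.card + H.card = q + 1 ∧ H ⊆ Icc 1 q := by
  obtain ⟨q, hinter, hunion⟩ := hH
  refine ⟨q, (mem_inter.1 (hinter ▸ mem_singleton_self q)).1, ?_,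
    hunion ▸ subset_union_right⟩
  rw [← card_union_add_card_inter, hinter, hunion]
  simp

lemma IsKPartner.mem_ksubsets {n k : ℕ} {A K : Finset ℕ} (hA : A ⊆ ground n)
    (hn : A.card + k ≤ n) (hK : IsKPartner n k A K) : K ∈ ksubsets n k := by
  obtain ⟨H, hH, h⟩ := hK
  obtain ⟨q, hqA, hcard, hHq⟩ := hH.exists_last
  have hqn : q ≤ n := (mem_Icc.1 (hA hqA)).2
  have hHn : H ⊆ ground n := hHq.trans (Icc_subset_Icc_right hqn)
  rcases h with ⟨rfl, rfl⟩ | ⟨hlt, rfl⟩ | ⟨_, h, _⟩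
  · exact mem_powersetCard.2 ⟨hHn, rfl⟩
  · refine mem_powersetCard.2 ⟨union_subset hHn (Icc_subset_Icc_left (by omega)), ?_⟩
    rw [card_union_of_disjoint, Nat.card_Icc]
    · omega
    · rw [disjoint_left]
      intro x hx hx'
      have h1 := mem_Icc.1 (hHq hx)
      have h2 := mem_Icc.1 hx'
      omega
  · exact h

/-- Among sets at least as large, adjoining a final segment of `[n]` to `H` gives the last set
preceding `H`. -/
lemma lex_union_Icc {n m q : ℕ} {H K : Finset ℕ} (hHq : H ⊆ Icc 1 q) (hqm : q < m)
    (hK : K ⊆ ground n) (hcard : (H ∪ Icc m n).card ≤ K.card) (h : lex K H) :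
    lex K (H ∪ Icc m n) := by
  rw [lex_iff_not_firstDiffIn] at h ⊢
  rintro ⟨x, hx, hxK, hagree⟩
  have hHm : ∀ y ∈ H, y < m := fun y hy => (mem_Icc.1 (hHq hy)).2.trans_lt hqm
  simp only [mem_union, mem_Icc] at hx hagree
  by_cases hxH : x ∈ H
  · exact h ⟨x, hxH, hxK, fun y hy => by grind⟩
  · have hxm := hx.resolve_left hxH
    have hsub : K ⊆ (H ∪ Icc m n).erase x := by
      intro y hy
      have hyn := mem_Icc.1 (hK hy)
      have hyx : y ≠ x := fun e => hxK (e ▸ hy)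
      simp only [mem_erase, mem_union, mem_Icc]
      refine ⟨hyx, ?_⟩
      rcases hyx.lt_or_gt with hlt | hgt
      · exact (hagree y hlt).2 hy
      · exact .inr ⟨by omega, hyn.2⟩
    have h1 := card_le_card hsub
    have h2 : ((H ∪ Icc m n).erase x).card < (H ∪ Icc m n).card :=
      card_erase_lt_of_mem (by simpa using hx)
    omega

/-- The `k`-partner of `A` is the last `k`-subset whose complement strictly follows `A`. -/
lemma IsKPartner.lex_iff {n k : ℕ} {A L K : Finset ℕ} (hA : A ⊆ ground n)
    (hn : A.card + k ≤ n) (hL : IsKPartner n k A L) (hK : K ∈ ksubsets n k) :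
    lex K L ↔ FirstDiffIn A (ground n \ K) := by
  have hLmem := hL.mem_ksubsets hA hn
  obtain ⟨H, hH, h⟩ := hL
  obtain ⟨hKn, hKcard⟩ := mem_powersetCard.1 hK
  obtain ⟨q, hqA, hcard, hHq⟩ := hH.exists_last
  have hqn : q ≤ n := (mem_Icc.1 (hA hqA)).2
  rw [← hH.lex_iff hA hKn]
  rcases h with ⟨_, rfl⟩ | ⟨hlt, rfl⟩ | ⟨_, _, hLH, hlast⟩
  · rfl
  · refine ⟨fun h => lex_trans h (.inl subset_union_left), fun h => ?_⟩
    refine lex_union_Icc hHq (by omega) hKn ?_ h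
    rw [hKcard, (mem_powersetCard.1 hLmem).2]
  · exact ⟨fun h => lex_trans h hLH, hlast K hK⟩

lemma tailPart_subset (n : ℕ) (F : Finset ℕ) : tailPart n F ⊆ F := by
  have hne : ((range (n + 1)).filter fun x => Icc (n - x + 1) n ⊆ F).Nonempty :=
    ⟨0, by simp⟩
  obtain ⟨x, hx, he⟩ := exists_mem_eq_sup _ hne id
  rw [tailPart, ell, he]
  exact (mem_filter.1 hx).2

/-- Passing to a smaller parity does not change which sets of size at least `|B|` strictly
follow. -/
lemma IsParity.firstDiffIn_iff {n : ℕ} {A B C : Finset ℕ} (hAB : IsParity n A B)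
    (hcard : A.card ≤ B.card) (hC : C ⊆ ground n) (hBC : B.card ≤ C.card) :
    FirstDiffIn A C ↔ FirstDiffIn B C := by
  obtain ⟨hcore, hell⟩ := hAB
  have hle : ell n A ≤ ell n B := by omega
  have htA := tailPart_subset n A
  have htB := tailPart_subset n B
  have htAB : tailPart n A ⊆ tailPart n B := Icc_subset_Icc_left (by omega)
  have hsub : A ⊆ B := by
    rw [← sdiff_union_of_subset htA, hcore, ← sdiff_union_of_subset htB]
    grind
  constructor
  · intro h
    have hlex : lex B A := .inl hsub
    rcases (lex_iff_eq_or_firstDiffIn B A).1 hlex with rfl | h'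
    · exact h
    · exact h'.trans h
  · rintro ⟨x, hxB, hxC, hx⟩
    have hout : ∀ y, y < n - ell n B + 1 → (y ∈ A ↔ y ∈ B) := by
      intro y hy
      have hyB : y ∉ tailPart n B := fun h => by
        have := mem_Icc.1 h
        omega
      have hyA : y ∉ tailPart n A := fun h => hyB (htAB h)
      have := congrArg (y ∈ ·) hcore
      simpa [hyA, hyB] using this
    by_cases hxt : x < n - ell n B + 1
    · exact ⟨x, (hout x hxt).2 hxB, hxC, fun y hy => (hout y (hy.trans hxt)).trans (hx y hy)⟩
    · have hCB : C ⊆ B.erase x := by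
        intro y hy
        have hyn := mem_Icc.1 (hC hy)
        have hyx : y ≠ x := fun e => hxC (e ▸ hy)
        refine mem_erase.2 ⟨hyx, ?_⟩
        rcases hyx.lt_or_gt with hlt | hgt
        · exact (hx y hlt).2 hy
        · exact htB (mem_Icc.2 ⟨by omega, hyn.2⟩)
      have h1 := card_le_card hCB
      have h2 := card_erase_lt_of_mem hxB
      omega

/-- `k`-partners reverse the lexicographic order; parities have equal
`k`-partners. -/
theorem kpartner_antitone (a b k n : ℕ) (ha : 0 < a) (hb : 0 < b) (hk : 0 < k)
    (hn1 : a + k ≤ n) (hn2 : b + k ≤ n)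
    (A B Ka Kb : Finset ℕ) (hA : A ⊆ ground n) (hB : B ⊆ ground n)
    (hAcard : A.card = a) (hBcard : B.card = b)
    (hKa : IsKPartner n k A Ka) (hKb : IsKPartner n k B Kb) :
    (lex A B → lex Kb Ka) ∧ (a ≤ b → IsParity n A B → Kb = Ka) := by
  subst hAcard hBcard
  have hKam := hKa.mem_ksubsets hA hn1
  have hKbm := hKb.mem_ksubsets hB hn2
  have hcompl : ∀ K ∈ ksubsets n k, (ground n \ K).card = n - k := by
    intro K hK
    obtain ⟨hKn, hKcard⟩ := mem_powersetCard.1 hK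
    rw [card_sdiff_of_subset hKn, hKcard, ground, Nat.card_Icc, Nat.add_sub_cancel]
  constructor
  · intro h
    rw [hKa.lex_iff hA hn1 hKbm]
    have hBK := (hKb.lex_iff hB hn2 hKbm).1 (lex_refl Kb)
    rcases (lex_iff_eq_or_firstDiffIn A B).1 h with rfl | h
    · exact hBK
    · exact h.trans hBK
  · intro hab hpar
    have key : ∀ K ∈ ksubsets n k, (lex K Ka ↔ lex K Kb) := fun K hK => by
      rw [hKa.lex_iff hA hn1 hK, hKb.lex_iff hB hn2 hK]
      exact hpar.firstDiffIn_iff hab sdiff_subset (by rw [hcompl K hK]; omega)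
    exact lex_antisymm ((key Kb hKbm).2 (lex_refl Kb)) ((key Ka hKam).1 (lex_refl Ka))
end
end

section
/- Let f, g, h, n be positive integers with f ≥ g and n ≥ f + h. Define ℱ = {F ∈ C([n],f) : there exists H ∈ C([n],h) such that (F,H) is maximal} and 𝒢 = {G ∈ C([n],g) : there exists H ∈ C([n],h) such that (G,H) is maximal}. Let ℋ_ℱ ⊆ C([n],h) and ℋ_𝒢 ⊆ C([n],h) be families such that ℱ and ℋ_ℱ are maximal pair families and 𝒢 and ℋ_𝒢 are maximal pair families. Then: ℱ is the f-parity of 𝒢; ℋ_𝒢 ⊆ ℋ_ℱ; and for every G ∈ 𝒢, if F ∈ ℱ is the f-parity of G and H is such that (F,H) is maximal, then (G,H) is maximal. -/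
open Finset

attribute [local instance] Classical.propDecidable

noncomputable section

/-- Every element of `F` beyond `q` belongs to a final segment of `[n]` contained in `F`. -/
def FinalBeyond (n q : ℕ) (F : Finset ℕ) : Prop :=
  ∀ a ∈ F, q < a → ∀ b, a < b → b ≤ n → b ∈ F

/-- `F ∩ [q]` and `H ∩ [q]` strongly intersect at `q`, and both sets continue
after `q` with a final segment of `[n]` only. -/
structure MeetsAt (n q : ℕ) (F H : Finset ℕ) : Prop where
  left_mem : q ∈ F
  right_mem : q ∈ H
  compl : ∀ d, 1 ≤ d → d < q → (d ∈ F ↔ d ∉ H)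
  left_final : FinalBeyond n q F
  right_final : FinalBeyond n q H

/-- `A ≺ F` as far as it can be seen on `[q]`. -/
def PrefixLex (q : ℕ) (A F : Finset ℕ) : Prop :=
  (∀ e ≤ q, e ∈ F → e ∈ A) ∨ ∃ d < q, d ∈ A ∧ d ∉ F ∧ ∀ e < d, e ∈ F → e ∈ A

lemma mem_ksubsets_iff {n k : ℕ} {A : Finset ℕ} :
    A ∈ ksubsets n k ↔ (∀ x ∈ A, 1 ≤ x ∧ x ≤ n) ∧ A.card = k := by
  simp [ksubsets, ground, Finset.mem_powersetCard, Finset.subset_iff]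

lemma mem_Lset_iff {n k : ℕ} {A R : Finset ℕ} :
    A ∈ Lset n R k ↔ A ∈ ksubsets n k ∧ lex A R := by
  simp [Lset]

lemma lex_iff {A B : Finset ℕ} :
    lex A B ↔ B ⊆ A ∨ ∃ d ∈ A, d ∉ B ∧ ∀ e < d, e ∈ B → e ∈ A := by
  unfold lex
  refine or_congr_right ⟨fun h => ?_, ?_⟩
  · have hne : (A \ B).Nonempty := by
      rw [Finset.nonempty_iff_ne_empty]
      intro h0
      simp [h0] at h
    obtain ⟨d, hd⟩ := Finset.min_of_nonempty hne
    have hdm := Finset.mem_sdiff.1 (Finset.mem_of_min hd)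
    refine ⟨d, hdm.1, hdm.2, fun e he heB => ?_⟩
    by_contra heA
    have h1 := Finset.min_le (Finset.mem_sdiff.2 ⟨heB, heA⟩)
    have h2 := lt_of_lt_of_le h h1
    rw [hd] at h2
    exact absurd (WithTop.coe_lt_coe.1 h2) (by omega)
  · rintro ⟨d, hdA, hdB, h⟩
    have h1 := Finset.min_le (Finset.mem_sdiff.2 ⟨hdA, hdB⟩)
    refine lt_of_le_of_lt h1 ?_
    rcases (B \ A).eq_empty_or_nonempty with h0 | h0
    · simp [h0]
    · obtain ⟨e, he⟩ := Finset.min_of_nonempty h0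
      have hem := Finset.mem_sdiff.1 (Finset.mem_of_min he)
      rw [he]
      refine WithTop.coe_lt_coe.2 ?_
      by_contra hlt
      rcases Nat.lt_or_ge e d with h2 | h2
      · exact hem.2 (h e h2 hem.1)
      · have : e = d := by omega
        exact hdB (this ▸ hem.1)

lemma exists_first_diff_of_not_lex {A F : Finset ℕ} (h : ¬ lex A F) :
    ∃ d ∈ F, d ∉ A ∧ ∀ e < d, (e ∈ A ↔ e ∈ F) := by
  rw [lex_iff, not_or] at h
  obtain ⟨h1, h2⟩ := h
  have hne : ∃ d, d ∈ F ∧ d ∉ A := by simpa [Finset.subset_iff] using h1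
  have hmin : ∀ e < Nat.find hne, e ∈ F → e ∈ A := fun e he heF => by
    by_contra heA
    exact Nat.find_min hne he ⟨heF, heA⟩
  refine ⟨Nat.find hne, (Nat.find_spec hne).1, (Nat.find_spec hne).2, fun e he =>
    ⟨fun heA => ?_, hmin e he⟩⟩
  by_contra heF
  exact h2 ⟨e, heA, heF, fun e' he' => hmin e' (by omega)⟩

lemma exists_first_diff_le {n q f : ℕ} {A F : Finset ℕ} (hF : F.card = f)
    (hA : A ∈ ksubsets n f) (hfin : FinalBeyond n q F) (h : ¬ lex A F) :
    ∃ d ≤ q, d ∈ F ∧ d ∉ A ∧ ∀ e < d, (e ∈ A ↔ e ∈ F) := by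
  obtain ⟨d, hdF, hdA, hd⟩ := exists_first_diff_of_not_lex h
  rw [mem_ksubsets_iff] at hA
  refine ⟨d, ?_, hdF, hdA, hd⟩
  by_contra hdq
  have hsub : A ⊆ F := fun e he => by
    rcases lt_trichotomy e d with h1 | h1 | h1
    · exact (hd e h1).1 he
    · exact h1 ▸ hdF
    · exact hfin d hdF (by omega) e h1 (hA.1 e he).2
  have := Finset.eq_of_subset_of_card_le hsub (by omega)
  exact hdA (this ▸ hdF)

lemma prefixLex_of_lex {q : ℕ} {A F : Finset ℕ} (hq : q ∈ F) (h : lex A F) :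
    PrefixLex q A F := by
  rcases lex_iff.1 h with h | ⟨d, hdA, hdF, h⟩
  · exact Or.inl fun e _ he => h he
  · rcases lt_trichotomy d q with h1 | h1 | h1
    · exact Or.inr ⟨d, h1, hdA, hdF, h⟩
    · exact absurd (h1 ▸ hq) hdF
    · exact Or.inl fun e he => h e (by omega)

/-- An `f`-set avoiding `X` that contains `d` and the part of `F` below `d`. -/
lemma exists_disjoint_extension {n f h q d : ℕ} {F X : Finset ℕ} (hn : f + h ≤ n)
    (hF : F ∈ ksubsets n f) (hX : X ∈ ksubsets n h) (hq : q ∈ F) (hd1 : 1 ≤ d) (hdq : d ≤ q)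
    (hdX : d ∉ X) (hlow : ∀ e < d, e ∈ F → e ∉ X) :
    ∃ A ∈ ksubsets n f, Disjoint A X ∧ d ∈ A ∧ ∀ e < d, e ∈ F → e ∈ A := by
  rw [mem_ksubsets_iff] at hF hX
  have hsub : insert d (F.filter (· < d)) ⊆ Finset.Icc 1 n \ X := by
    intro e he
    simp only [Finset.mem_insert, Finset.mem_filter, Finset.mem_sdiff, Finset.mem_Icc] at he ⊢
    rcases he with rfl | ⟨heF, hed⟩
    · exact ⟨⟨hd1, hdq.trans (hF.1 q hq).2⟩, hdX⟩
    · exact ⟨hF.1 e heF, hlow e hed heF⟩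
  have hcard : (insert d (F.filter (· < d))).card ≤ f := by
    have h1 : F.filter (· < d) ⊆ F.erase q := fun e he => by
      simp only [Finset.mem_filter, Finset.mem_erase] at he ⊢
      exact ⟨by omega, he.1⟩
    have h2 := Finset.card_le_card h1
    have h3 := Finset.card_erase_of_mem hq
    have h4 := Finset.card_pos.2 ⟨q, hq⟩
    have h5 := Finset.card_insert_le d (F.filter (· < d))
    omega
  have hbig : f ≤ (Finset.Icc 1 n \ X).card := by
    have h1 : X ⊆ Finset.Icc 1 n := fun x hx => Finset.mem_Icc.2 (hX.1 x hx)
    rw [Finset.card_sdiff_of_subset h1, Nat.card_Icc]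
    omega
  obtain ⟨A, hA1, hA2, hA3⟩ := Finset.exists_subsuperset_card_eq hsub hcard hbig
  refine ⟨A, mem_ksubsets_iff.2 ⟨fun x hx => ?_, hA3⟩, ?_, hA1 (by simp), fun e he heF =>
    hA1 (by simp [he, heF])⟩
  · exact Finset.mem_Icc.1 (Finset.mem_sdiff.1 (hA2 hx)).1
  · exact Finset.disjoint_left.2 fun x hx => (Finset.mem_sdiff.1 (hA2 hx)).2

lemma PairMaximal.symm {n : ℕ} {F H : Finset ℕ} (h : PairMaximal n F H) :
    PairMaximal n H F := by
  obtain ⟨h1, h2, h3, h4⟩ := h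
  refine ⟨h2, h1, fun a ha b hb => ?_, fun F' G' hF hF' hG hG' hc => ?_⟩
  · rw [Finset.inter_comm]
    exact h3 b hb a ha
  · refine (h4 G' F' hG hG' hF hF' fun a ha b hb => ?_).symm
    rw [Finset.inter_comm]
    exact hc b hb a ha

lemma MeetsAt.symm {n q : ℕ} {F H : Finset ℕ} (m : MeetsAt n q F H) : MeetsAt n q H F where
  left_mem := m.right_mem
  right_mem := m.left_mem
  compl d h1 h2 := by have := m.compl d h1 h2; tauto
  left_final := m.right_final
  right_final := m.left_final

lemma inter_nonempty_of_prefixLex {n q : ℕ} {F H A B : Finset ℕ} (hqF : q ∈ F) (hqH : q ∈ H)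
    (hc : ∀ d, 1 ≤ d → d < q → (d ∈ F ↔ d ∉ H))
    (hA1 : ∀ x ∈ A, 1 ≤ x ∧ x ≤ n) (hB1 : ∀ x ∈ B, 1 ≤ x ∧ x ≤ n)
    (hA : PrefixLex q A F) (hB : PrefixLex q B H) : (A ∩ B).Nonempty := by
  rcases hA with hA | ⟨d, hdq, hdA, hdF, hA⟩ <;> rcases hB with hB | ⟨d', hdq', hdB, hdH, hB⟩
  · exact ⟨q, Finset.mem_inter.2 ⟨hA q le_rfl hqF, hB q le_rfl hqH⟩⟩
  · have := hc d' (hB1 d' hdB).1 hdq'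
    exact ⟨d', Finset.mem_inter.2 ⟨hA d' hdq'.le (by tauto), hdB⟩⟩
  · have := hc d (hA1 d hdA).1 hdq
    exact ⟨d, Finset.mem_inter.2 ⟨hdA, hB d hdq.le (by tauto)⟩⟩
  · have h1 := hc d' (hB1 d' hdB).1 hdq'
    have h2 := hc d (hA1 d hdA).1 hdq
    rcases lt_trichotomy d d' with h3 | h3 | h3
    · exact ⟨d, Finset.mem_inter.2 ⟨hdA, hB d h3 (by tauto)⟩⟩
    · exact ⟨d, Finset.mem_inter.2 ⟨hdA, h3 ▸ hdB⟩⟩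
    · exact ⟨d', Finset.mem_inter.2 ⟨hA d' h3 (by tauto), hdB⟩⟩

lemma MeetsAt.exists_disjoint {n q f h : ℕ} {F H A : Finset ℕ} (m : MeetsAt n q F H)
    (hn : f + h ≤ n) (hF : F ∈ ksubsets n f) (hH : H ∈ ksubsets n h) (hA : A ∈ ksubsets n f)
    (hlex : ¬ lex A F) : ∃ B ∈ Lset n H h, Disjoint A B := by
  have hF' := mem_ksubsets_iff.1 hF
  have hH' := mem_ksubsets_iff.1 hH
  obtain ⟨d, hdq, hdF, hdA, hd⟩ := exists_first_diff_le hF'.2 hA m.left_final hlex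
  obtain ⟨B, hB, hdis, hdB, hBlow⟩ := exists_disjoint_extension (q := q) (d := d)
    (by omega : h + f ≤ n) hH hA m.right_mem (hF'.1 d hdF).1 hdq hdA fun e he heH heA =>
      (m.compl e (hH'.1 e heH).1 (by omega)).1 ((hd e he).1 heA) heH
  refine ⟨B, mem_Lset_iff.2 ⟨hB, ?_⟩, hdis.symm⟩
  by_contra hnl
  obtain ⟨d', hdq', hdH', hdB', hd'⟩ := exists_first_diff_le hH'.2 hB m.right_final hnl
  rcases lt_trichotomy d d' with h1 | h1 | h1
  · exact (m.compl d (hF'.1 d hdF).1 (by omega)).1 hdF ((hd' d h1).1 hdB)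
  · exact hdB' (h1 ▸ hdB)
  · exact hdB' (hBlow d' h1 hdH')

lemma MeetsAt.pairMaximal {n q f h : ℕ} {F H : Finset ℕ} (m : MeetsAt n q F H)
    (hn : f + h ≤ n) (hF : F ∈ ksubsets n f) (hH : H ∈ ksubsets n h) : PairMaximal n F H := by
  have key : ∀ {f h : ℕ} {F H : Finset ℕ}, MeetsAt n q F H → f + h ≤ n → F ∈ ksubsets n f →
      H ∈ ksubsets n h → ∀ F' G' : Finset (Finset ℕ), F' ⊆ ksubsets n f → Lset n H h ⊆ G' →
      CrossInt F' G' → F' ⊆ Lset n F f := by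
    intro f h F H m hn hF hH F' G' hF' hG hc A hA
    refine mem_Lset_iff.2 ⟨hF' hA, ?_⟩
    by_contra hnl
    obtain ⟨B, hB, hdis⟩ := m.exists_disjoint hn hF hH (hF' hA) hnl
    exact (hc A hA B (hG hB)).ne_empty (Finset.disjoint_iff_inter_eq_empty.1 hdis)
  unfold PairMaximal
  rw [(mem_ksubsets_iff.1 hF).2, (mem_ksubsets_iff.1 hH).2]
  refine ⟨Finset.filter_subset _ _, Finset.filter_subset _ _, fun A hA B hB => ?_,
    fun F' G' hFF hF' hGG hG' hc => ⟨hFF.antisymm (key m hn hF hH F' G' hF' hGG hc),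
      hGG.antisymm (key m.symm (by omega) hH hF G' F' hG' hFF fun a ha b hb => ?_)⟩⟩
  · rw [mem_Lset_iff, mem_ksubsets_iff] at hA hB
    exact inter_nonempty_of_prefixLex m.left_mem m.right_mem m.compl hA.1.1 hB.1.1
      (prefixLex_of_lex m.left_mem hA.2) (prefixLex_of_lex m.right_mem hB.2)
  · rw [Finset.inter_comm]
    exact hc b hb a ha

lemma finalBeyond_of_lex {n q f : ℕ} {F : Finset ℕ} (hF : F ∈ ksubsets n f)
    (h : ∀ A ∈ ksubsets n f, PrefixLex q A F → lex A F) : FinalBeyond n q F := by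
  intro a ha hqa b hab hbn
  by_contra hb
  rw [mem_ksubsets_iff] at hF
  have hlex : lex (insert b (F.erase a)) F := by
    refine h _ (mem_ksubsets_iff.2 ⟨fun x hx => ?_, ?_⟩) (Or.inl fun e he heF => ?_)
    · rcases Finset.mem_insert.1 hx with rfl | hx
      · omega
      · exact hF.1 x (Finset.mem_of_mem_erase hx)
    · rw [Finset.card_insert_of_notMem (by simp [hb]), Finset.card_erase_of_mem ha]
      have := Finset.card_pos.2 ⟨a, ha⟩
      omega
    · simp only [Finset.mem_insert, Finset.mem_erase]
      exact Or.inr ⟨by omega, heF⟩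
  have haA : a ∉ insert b (F.erase a) := by simp [hab.ne]
  rcases lex_iff.1 hlex with h1 | ⟨d, hdA, hdF, h1⟩
  · exact haA (h1 ha)
  · have : d = b := by
      rcases Finset.mem_insert.1 hdA with h2 | h2
      · exact h2
      · exact absurd (Finset.mem_of_mem_erase h2) hdF
    exact haA (h1 a (by omega) ha)

lemma PairMaximal.exists_meetsAt {n f h : ℕ} {F H : Finset ℕ} (hn : f + h ≤ n)
    (hF : F ∈ ksubsets n f) (hH : H ∈ ksubsets n h) (hm : PairMaximal n F H) :
    ∃ q, MeetsAt n q F H := by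
  have hF' := mem_ksubsets_iff.1 hF
  have hH' := mem_ksubsets_iff.1 hH
  unfold PairMaximal at hm
  rw [hF'.2, hH'.2] at hm
  obtain ⟨-, -, hc, hmax⟩ := hm
  have hFL : F ∈ Lset n F f := mem_Lset_iff.2 ⟨hF, lex_refl F⟩
  have hHL : H ∈ Lset n H h := mem_Lset_iff.2 ⟨hH, lex_refl H⟩
  have hex : ∃ q, q ∈ F ∧ q ∈ H := by
    obtain ⟨q, hq⟩ := hc F hFL H hHL
    exact ⟨q, Finset.mem_inter.1 hq⟩
  obtain ⟨q, ⟨hqF, hqH⟩, hqmin⟩ : ∃ q, (q ∈ F ∧ q ∈ H) ∧ ∀ e < q, ¬ (e ∈ F ∧ e ∈ H) :=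
    ⟨Nat.find hex, Nat.find_spec hex, fun e he => Nat.find_min hex he⟩
  have hcompl : ∀ d, 1 ≤ d → d < q → (d ∈ F ↔ d ∉ H) := by
    intro d hd1 hdq
    refine ⟨fun h1 h2 => hqmin d hdq ⟨h1, h2⟩, fun h2 => ?_⟩
    by_contra h1
    obtain ⟨A, hA, hdis, hdA, hlow⟩ := exists_disjoint_extension hn hF hH hqF hd1 hdq.le h2
      fun e he heF heH => hqmin e (by omega) ⟨heF, heH⟩
    have hAL : A ∈ Lset n F f := mem_Lset_iff.2 ⟨hA, lex_iff.2 (Or.inr ⟨d, hdA, h1, hlow⟩)⟩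
    exact (hc A hAL H hHL).ne_empty (Finset.disjoint_iff_inter_eq_empty.1 hdis)
  have hsub : ∀ {k : ℕ} {R : Finset ℕ}, q ∈ R →
      Lset n R k ⊆ (ksubsets n k).filter (PrefixLex q · R) := fun hq A hA => by
    rw [mem_Lset_iff] at hA
    exact Finset.mem_filter.2 ⟨hA.1, prefixLex_of_lex hq hA.2⟩
  obtain ⟨e1, e2⟩ := hmax _ _ (hsub hqF) (Finset.filter_subset _ _) (hsub hqH)
    (Finset.filter_subset _ _) fun A hA B hB => by
      rw [Finset.mem_filter, mem_ksubsets_iff] at hA hB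
      exact inter_nonempty_of_prefixLex hqF hqH hcompl hA.1.1 hB.1.1 hA.2 hB.2
  exact ⟨q, hqF, hqH, hcompl,
    finalBeyond_of_lex hF fun A hA hp =>
      (mem_Lset_iff.1 (e1 ▸ Finset.mem_filter.2 ⟨hA, hp⟩)).2,
    finalBeyond_of_lex hH fun A hA hp =>
      (mem_Lset_iff.1 (e2 ▸ Finset.mem_filter.2 ⟨hA, hp⟩)).2⟩

lemma MeetsAt.succ_notMem {n q f h : ℕ} {F H : Finset ℕ} (m : MeetsAt n q F H)
    (hn : f + h ≤ n) (hF : F ∈ ksubsets n f) (hH : H ∈ ksubsets n h) :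
    q + 1 ≤ n ∧ q + 1 ∉ F := by
  rw [mem_ksubsets_iff] at hF hH
  obtain ⟨x, hqx, hxn, hxF⟩ : ∃ x, q < x ∧ x ≤ n ∧ x ∉ F := by
    by_contra! hall
    have hcov : Finset.Icc 1 n ⊆ F ∪ H := fun d hd => by
      rw [Finset.mem_Icc] at hd
      rw [Finset.mem_union]
      rcases lt_trichotomy d q with h1 | h1 | h1
      · have := m.compl d hd.1 h1
        tauto
      · exact Or.inl (h1 ▸ m.left_mem)
      · exact Or.inl (hall d h1 hd.2)
    have h1 := Finset.card_le_card hcov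
    have h2 := Finset.card_union_add_card_inter F H
    have h3 := Finset.card_pos.2 ⟨q, Finset.mem_inter.2 ⟨m.left_mem, m.right_mem⟩⟩
    rw [Nat.card_Icc] at h1
    omega
  refine ⟨by omega, fun hq => ?_⟩
  rcases Nat.lt_or_ge (q + 1) x with h1 | h1
  · exact hxF (m.left_final _ hq (by omega) x h1 hxn)
  · exact hxF ((show q + 1 = x by omega) ▸ hq)

lemma MeetsAt.right_unique {n q q' f h : ℕ} {F H H' : Finset ℕ} (m : MeetsAt n q F H)
    (m' : MeetsAt n q' F H') (hn : f + h ≤ n) (hF : F ∈ ksubsets n f) (hH : H ∈ ksubsets n h)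
    (hH' : H' ∈ ksubsets n h) : H = H' := by
  have s := m.succ_notMem hn hF hH
  have s' := m'.succ_notMem hn hF hH'
  rw [mem_ksubsets_iff] at hF hH hH'
  have hqq : q = q' := by
    rcases lt_trichotomy q q' with h1 | h1 | h1
    · exact absurd (m.left_final q' m'.left_mem h1 (q' + 1) (by omega) s'.1) s'.2
    · exact h1
    · exact absurd (m'.left_final q m.left_mem h1 (q + 1) (by omega) s.1) s.2
  subst hqq
  have hlow : ∀ d, 1 ≤ d → d ≤ q → (d ∈ H ↔ d ∈ H') := by
    intro d h1 h2
    rcases h2.eq_or_lt with rfl | h2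
    · simp [m.right_mem, m'.right_mem]
    · have a := m.compl d h1 h2
      have b := m'.compl d h1 h2
      tauto
  by_cases hsub : H ⊆ H'
  · exact Finset.eq_of_subset_of_card_le hsub (by omega)
  · obtain ⟨x, hx, hx'⟩ := Finset.not_subset.1 hsub
    have hqx : q < x := by
      by_contra hle
      exact hx' ((hlow x (hH.1 x hx).1 (by omega)).1 hx)
    refine (Finset.eq_of_subset_of_card_le (fun y hy => ?_) (by omega)).symm
    rcases Nat.lt_or_ge q y with h1 | h1
    · rcases lt_trichotomy x y with h2 | h2 | h2
      · exact m.right_final x hx hqx y h2 (hH'.1 y hy).2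
      · exact h2 ▸ hx
      · exact absurd (m'.right_final y hy h1 x h2 (hH.1 x hx).2) hx'
    · exact (hlow y (hH'.1 y hy).1 h1).2 hy

lemma PairMaximal.right_unique {n f h : ℕ} {F H H' : Finset ℕ} (hn : f + h ≤ n)
    (hF : F ∈ ksubsets n f) (hH : H ∈ ksubsets n h) (hH' : H' ∈ ksubsets n h)
    (hm : PairMaximal n F H) (hm' : PairMaximal n F H') : H = H' := by
  obtain ⟨q, m⟩ := hm.exists_meetsAt hn hF hH
  obtain ⟨q', m'⟩ := hm'.exists_meetsAt hn hF hH'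
  exact m.right_unique m' hn hF hH hH'

lemma ell_le (n : ℕ) (F : Finset ℕ) : ell n F ≤ n :=
  Finset.sup_le fun x hx => by
    have := Finset.mem_range.1 (Finset.mem_filter.1 hx).1
    simp only [id]
    omega

lemma mem_tailPart_iff {n x : ℕ} {F : Finset ℕ} :
    x ∈ tailPart n F ↔ (1 ≤ x ∧ x ≤ n) ∧ ∀ y, x ≤ y → y ≤ n → y ∈ F := by
  constructor
  · intro hx
    have hx' := Finset.mem_Icc.1 hx
    refine ⟨⟨by omega, hx'.2⟩, fun y h1 h2 => tailPart_subset n F ?_⟩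
    exact Finset.mem_Icc.2 ⟨by omega, h2⟩
  · rintro ⟨⟨h1, h2⟩, h3⟩
    have hmem : n + 1 - x ∈
        (Finset.range (n + 1)).filter fun x => Finset.Icc (n - x + 1) n ⊆ F := by
      refine Finset.mem_filter.2 ⟨Finset.mem_range.2 (by omega), fun y hy => ?_⟩
      rw [Finset.mem_Icc] at hy
      exact h3 y (by omega) hy.2
    have : n + 1 - x ≤ ell n F := Finset.le_sup (f := id) hmem
    exact Finset.mem_Icc.2 ⟨by omega, h2⟩

lemma card_sdiff_tailPart_add_ell (n : ℕ) (F : Finset ℕ) :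
    (F \ tailPart n F).card + ell n F = F.card := by
  have h1 := Finset.card_sdiff_add_card_eq_card (tailPart_subset n F)
  have h2 : (tailPart n F).card = ell n F := by
    have := ell_le n F
    rw [tailPart, Nat.card_Icc]
    omega
  omega

lemma isParity_of_sdiff_tailPart_eq {n : ℕ} {A B : Finset ℕ}
    (h : A \ tailPart n A = B \ tailPart n B) : IsParity n A B := by
  refine ⟨h, ?_⟩
  have h1 := card_sdiff_tailPart_add_ell n A
  have h2 := card_sdiff_tailPart_add_ell n B
  rw [h] at h1
  omega

lemma MeetsAt.sdiff_tailPart {n q f h : ℕ} {F H : Finset ℕ} (m : MeetsAt n q F H)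
    (hn : f + h ≤ n) (hF : F ∈ ksubsets n f) (hH : H ∈ ksubsets n h) :
    F \ tailPart n F = F.filter (· ≤ q) := by
  have s := m.succ_notMem hn hF hH
  rw [mem_ksubsets_iff] at hF
  ext x
  rw [Finset.mem_sdiff, Finset.mem_filter, mem_tailPart_iff]
  refine and_congr_right fun hx => ⟨fun h1 => ?_, fun h1 h2 => s.2 (h2.2 _ (by omega) s.1)⟩
  by_contra hlt
  refine h1 ⟨hF.1 x hx, fun y h2 h3 => ?_⟩
  rcases h2.eq_or_lt with rfl | h2
  · exact hx
  · exact m.left_final x hx (by omega) y h2 h3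

lemma PairMaximal.of_isParity {n f g h : ℕ} {A B H : Finset ℕ} (hfg : g ≤ f)
    (hn : f + h ≤ n) (hA : A ∈ ksubsets n g) (hB : B ∈ ksubsets n f) (hH : H ∈ ksubsets n h)
    (hpar : IsParity n A B) (hm : PairMaximal n B H) : PairMaximal n A H := by
  obtain ⟨q, m⟩ := hm.exists_meetsAt hn hB hH
  have hA' := mem_ksubsets_iff.1 hA
  have heq : A \ tailPart n A = B.filter (· ≤ q) := hpar.1.trans (m.sdiff_tailPart hn hB hH)
  have hmem : ∀ x, (x ∈ A ∧ x ∉ tailPart n A) ↔ (x ∈ B ∧ x ≤ q) := fun x => by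
    rw [← Finset.mem_sdiff, heq, Finset.mem_filter]
  have hq := (hmem q).2 ⟨m.left_mem, le_rfl⟩
  have hqn := hA'.1 q hq.1
  have hlow : ∀ d < q, (d ∈ A ↔ d ∈ B) := by
    refine fun d hd => ⟨fun hdA => ((hmem d).1 ⟨hdA, fun ht => hq.2 ?_⟩).1,
      fun hdB => ((hmem d).2 ⟨hdB, hd.le⟩).1⟩
    rw [mem_tailPart_iff] at ht ⊢
    exact ⟨hqn, fun y h1 h2 => ht.2 y (by omega) h2⟩
  refine MeetsAt.pairMaximal (q := q) ⟨hq.1, m.right_mem, fun d h1 h2 => ?_,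
    fun a ha hqa b hab hb => ?_, m.right_final⟩ (by omega : g + h ≤ n) hA hH
  · rw [hlow d h2]
    exact m.compl d h1 h2
  · have : a ∈ tailPart n A := by
      by_contra ht
      have := ((hmem a).1 ⟨ha, ht⟩).2
      omega
    exact (mem_tailPart_iff.1 this).2 b hab.le hb

lemma PairMaximal.exists_isParity {n f g h : ℕ} {A H : Finset ℕ} (hfg : g ≤ f)
    (hn : f + h ≤ n) (hA : A ∈ ksubsets n g) (hH : H ∈ ksubsets n h)
    (hm : PairMaximal n A H) : ∃ B ∈ ksubsets n f, IsParity n A B ∧ PairMaximal n B H := by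
  obtain ⟨q, m⟩ := hm.exists_meetsAt (by omega : g + h ≤ n) hA hH
  have hA' := mem_ksubsets_iff.1 hA
  have hH' := mem_ksubsets_iff.1 hH
  set P := A.filter (· ≤ q) with hP
  have hPg : P.card ≤ g := hA'.2 ▸ Finset.card_filter_le _ _
  have hcount : q + 1 ≤ P.card + h := by
    have hcov : Finset.Icc 1 q ⊆ P ∪ H := fun d hd => by
      rw [Finset.mem_Icc] at hd
      rw [Finset.mem_union, hP, Finset.mem_filter]
      rcases hd.2.eq_or_lt with rfl | h1
      · exact Or.inr m.right_mem
      · have := m.compl d hd.1 h1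
        tauto
    have h1 := Finset.card_le_card hcov
    have h2 := Finset.card_union_add_card_inter P H
    have h3 : 0 < (P ∩ H).card := Finset.card_pos.2 ⟨q, Finset.mem_inter.2
      ⟨Finset.mem_filter.2 ⟨m.left_mem, le_rfl⟩, m.right_mem⟩⟩
    rw [Nat.card_Icc] at h1
    omega
  set B := P ∪ Finset.Icc (n - (f - P.card) + 1) n with hBdef
  have hmemB : ∀ x, x ∈ B ↔ (x ∈ A ∧ x ≤ q) ∨ (n - (f - P.card) + 1 ≤ x ∧ x ≤ n) := fun x => by
    rw [hBdef, Finset.mem_union, hP, Finset.mem_filter, Finset.mem_Icc]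
  have hB : B ∈ ksubsets n f := by
    refine mem_ksubsets_iff.2 ⟨fun x hx => ?_, ?_⟩
    · rcases (hmemB x).1 hx with h1 | h1
      · exact hA'.1 x h1.1
      · omega
    · rw [hBdef, Finset.card_union_of_disjoint, Nat.card_Icc]
      · omega
      · refine Finset.disjoint_left.2 fun x hx hx' => ?_
        rw [hP, Finset.mem_filter] at hx
        rw [Finset.mem_Icc] at hx'
        omega
  have hlow : ∀ d ≤ q, (d ∈ B ↔ d ∈ A) := fun d hd => by
    rw [hmemB]
    constructor
    · rintro (h1 | h1)
      · exact h1.1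
      · omega
    · exact fun h1 => Or.inl ⟨h1, hd⟩
  have mB : MeetsAt n q B H := by
    refine ⟨(hlow q le_rfl).2 m.left_mem, m.right_mem, fun d h1 h2 => ?_,
      fun a ha hqa b hab hb => ?_, m.right_final⟩
    · rw [hlow d h2.le]
      exact m.compl d h1 h2
    · rcases (hmemB a).1 ha with h1 | h1
      · omega
      · exact (hmemB b).2 (Or.inr ⟨by omega, hb⟩)
  refine ⟨B, hB, isParity_of_sdiff_tailPart_eq ?_, mB.pairMaximal hn hB hH⟩
  rw [m.sdiff_tailPart (by omega : g + h ≤ n) hA hH, mB.sdiff_tailPart hn hB hH]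
  ext x
  rw [Finset.mem_filter, Finset.mem_filter]
  exact and_congr_left fun hx => (hlow x hx).symm

lemma MaximalPairFamilies.exists_left {n g h : ℕ} {G HG : Finset (Finset ℕ)} (hn : g + h ≤ n)
    (hG : G ⊆ ksubsets n g) (hHG : HG ⊆ ksubsets n h) (hm : MaximalPairFamilies n G HG)
    {H : Finset ℕ} (hH : H ∈ HG) : ∃ A ∈ G, PairMaximal n A H := by
  choose! p hp using fun A hA => (hm.2 A hA).exists
  have hinj : Set.InjOn p G := fun A hA B hB hAB =>
    PairMaximal.right_unique (by omega : h + g ≤ n) (hHG (hp A hA).1) (hG hA) (hG hB)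
      (hp A hA).2.symm (hAB ▸ (hp B hB).2.symm)
  obtain ⟨A, hA, rfl⟩ := Finset.surjOn_of_injOn_of_card_le p (fun A hA => (hp A hA).1) hinj
    hm.1.ge hH
  exact ⟨A, hA, (hp A hA).2⟩

/-- the family of `f`-sets admitting a maximal `h`-set partner is the
`f`-parity of the corresponding family of `g`-sets; moreover `ℋ_𝒢 ⊆ ℋ_ℱ`, and the
maximal partner transfers from the `f`-parity `F` of `G` to `G` itself. -/
theorem parity_of_maximal_families (f g h n : ℕ) (hf : 0 < f) (hg : 0 < g) (hh : 0 < h)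
    (hfg : g ≤ f) (hn : f + h ≤ n)
    (F G : Finset (Finset ℕ))
    (hF : F = (ksubsets n f).filter fun A => ∃ H ∈ ksubsets n h, PairMaximal n A H)
    (hG : G = (ksubsets n g).filter fun A => ∃ H ∈ ksubsets n h, PairMaximal n A H)
    (HF HG : Finset (Finset ℕ)) (hHF : HF ⊆ ksubsets n h) (hHG : HG ⊆ ksubsets n h)
    (hmpF : MaximalPairFamilies n F HF) (hmpG : MaximalPairFamilies n G HG) :
    FamParity n g f G F ∧ HG ⊆ HF ∧
      ∀ A ∈ G, ∀ B ∈ F, IsParity n A B →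
        ∀ H ∈ ksubsets n h, PairMaximal n B H → PairMaximal n A H := by
  have hGs : G ⊆ ksubsets n g := hG ▸ Finset.filter_subset _ _
  have hFs : F ⊆ ksubsets n f := hF ▸ Finset.filter_subset _ _
  have hlift : ∀ A ∈ ksubsets n g, ∀ H ∈ ksubsets n h, PairMaximal n A H →
      ∃ B ∈ F, IsParity n A B ∧ PairMaximal n B H := fun A hA H hH hm => by
    obtain ⟨B, hB, hpar, hm'⟩ := hm.exists_isParity hfg hn hA hH
    exact ⟨B, hF ▸ Finset.mem_filter.2 ⟨hB, H, hH, hm'⟩, hpar, hm'⟩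
  refine ⟨⟨fun A hA => ?_, fun B hB A hA hpar => ?_⟩, fun H hH => ?_,
    fun A hA B hB hpar H hH hm => hm.of_isParity hfg hn (hGs hA) (hFs hB) hH hpar⟩
  · rw [hG, Finset.mem_filter] at hA
    obtain ⟨hA, H, hH, hm⟩ := hA
    obtain ⟨B, hB, hpar, -⟩ := hlift A hA H hH hm
    exact ⟨B, hFs hB, hpar, hB⟩
  · rw [hF, Finset.mem_filter] at hB
    obtain ⟨hB, H, hH, hm⟩ := hB
    rw [hG, Finset.mem_filter]
    exact ⟨hA, H, hH, hm.of_isParity hfg hn hA hB hH hpar⟩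
  · obtain ⟨A, hA, hm⟩ := hmpG.exists_left (by omega) hGs hHG hH
    obtain ⟨B, hB, -, hm'⟩ := hlift A (hGs hA) H (hHG hH) hm
    obtain ⟨H', ⟨hH', hm''⟩, -⟩ := hmpF.2 B hB
    rw [PairMaximal.right_unique hn (hFs hB) (hHG hH) (hHF hH') hm' hm'']
    exact hH'
end
end

section
/- Let t ≥ 3, k1 > k2 ≥ ... ≥ kt ≥ 2 and k1 + k3 ≤ n < k1 + k2, and let (ℱ1,...,ℱt) be an extremal (n,k1,...,kt)-cross intersecting system in which every ℱi is L-initial. Then |ℱ1| ≥ C(n−1, k1−1) and |ℱ2| ≥ C(n−1, k2−1). -/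
open Finset

attribute [local instance] Classical.propDecidable

noncomputable section

/-- The full star at `1` in `C([n], k)`. -/
def fullStar (n k : ℕ) : Finset (Finset ℕ) := (ksubsets n k).filter fun A => 1 ∈ A

lemma mem_ksubsets {n k : ℕ} {A : Finset ℕ} :
    A ∈ ksubsets n k ↔ A ⊆ Finset.Icc 1 n ∧ A.card = k :=
  Finset.mem_powersetCard

lemma mem_star {n k : ℕ} {A : Finset ℕ} :
    A ∈ fullStar n k ↔ (A ⊆ Finset.Icc 1 n ∧ A.card = k) ∧ 1 ∈ A := by
  simp [fullStar, mem_ksubsets]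

lemma star_nonempty {n k : ℕ} (hk : 1 ≤ k) (hkn : k ≤ n) : (fullStar n k).Nonempty := by
  refine ⟨Finset.Icc 1 k, mem_star.2 ⟨⟨Finset.Icc_subset_Icc_right hkn, by simp⟩, ?_⟩⟩
  simpa using hk

lemma choose_le_card_star_disjoint {n k : ℕ} {S : Finset ℕ} (hk : 1 ≤ k) (hn : 1 ≤ n)
    (hS : S ⊆ Finset.Icc 2 n) :
    (n - 1 - S.card).choose (k - 1) ≤ ((fullStar n k).filter fun A => Disjoint S A).card := by
  have hcard : (Finset.Icc 2 n \ S).card = n - 1 - S.card := by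
    rw [Finset.card_sdiff_of_subset hS, Nat.card_Icc]
    omega
  rw [← hcard, ← Finset.card_powersetCard]
  have h1 : ∀ A ∈ Finset.powersetCard (k - 1) (Finset.Icc 2 n \ S), 1 ∉ A := by
    intro A hA h
    have := (Finset.mem_powersetCard.1 hA).1 h
    simp at this
  refine Finset.card_le_card_of_injOn (insert 1) ?_ ?_
  · intro A hA
    have h1A := h1 A hA
    obtain ⟨hsub, hAc⟩ := Finset.mem_powersetCard.1 hA
    have hAn : insert 1 A ⊆ Finset.Icc 1 n := by
      refine Finset.insert_subset (by simpa using hn) fun x hx => ?_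
      have := hsub hx
      simp only [Finset.mem_sdiff, Finset.mem_Icc] at this ⊢
      omega
    have hdisj : Disjoint S (insert 1 A) := by
      refine Finset.disjoint_insert_right.2 ⟨fun h => ?_, ?_⟩
      · simpa using hS h
      · exact (Finset.disjoint_of_subset_left hsub Finset.sdiff_disjoint).symm
    simp only [Finset.coe_filter, Set.mem_ofPred_eq]
    refine ⟨mem_star.2 ⟨⟨hAn, ?_⟩, by simp⟩, hdisj⟩
    rw [Finset.card_insert_of_notMem h1A]
    omega
  · intro A hA B hB hAB
    rw [← Finset.erase_insert (h1 A hA), ← Finset.erase_insert (h1 B hB)]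
    rw [hAB]

lemma choose_le_card_star {n k : ℕ} (hk : 1 ≤ k) (hn : 1 ≤ n) :
    (n - 1).choose (k - 1) ≤ (fullStar n k).card := by
  simpa using choose_le_card_star_disjoint (S := ∅) hk hn (by simp)

lemma subset_Icc_two {n : ℕ} {S : Finset ℕ} (hS : S ⊆ Finset.Icc 1 n) (h1 : 1 ∉ S) :
    S ⊆ Finset.Icc 2 n := by
  intro x hx
  have hne : x ≠ 1 := fun h => h1 (h ▸ hx)
  have := hS hx
  simp only [Finset.mem_Icc] at this ⊢
  omega

lemma exists_mem_star_disjoint {n k : ℕ} {S : Finset ℕ} (hk : 1 ≤ k)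
    (hS : S ⊆ Finset.Icc 1 n) (h1 : 1 ∉ S) (hSk : S.card + k ≤ n) :
    ∃ A ∈ fullStar n k, Disjoint S A := by
  have h := choose_le_card_star_disjoint (k := k) hk (by omega) (subset_Icc_two hS h1)
  have hpos : 0 < (n - 1 - S.card).choose (k - 1) := Nat.choose_pos (by omega)
  obtain ⟨A, hA⟩ := Finset.card_pos.1 (hpos.trans_le h)
  exact ⟨A, (Finset.mem_filter.1 hA).1, (Finset.mem_filter.1 hA).2⟩

/-- Double counting of disjoint pairs: a family of `c`-sets avoiding `1` excludes at least as
many members of the star of `a`-sets. -/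
lemma card_le_card_star_excluded {n a c : ℕ} {X : Finset (Finset ℕ)} (hca : c < a)
    (hn : a + c ≤ n) (hX : X ⊆ ksubsets n c) (hX1 : ∀ B ∈ X, 1 ∉ B) :
    X.card ≤ ((fullStar n a).filter fun A => ∃ B ∈ X, Disjoint B A).card := by
  set N := (fullStar n a).filter fun A => ∃ B ∈ X, Disjoint B A
  have habove : ∀ B ∈ X, (n - 1 - c).choose (a - 1) ≤
      (Finset.bipartiteAbove (fun B A : Finset ℕ => Disjoint B A) N B).card := by
    intro B hB
    obtain ⟨hBn, hBc⟩ := mem_ksubsets.1 (hX hB)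
    have h := choose_le_card_star_disjoint (k := a) (by omega) (by omega : 1 ≤ n)
      (subset_Icc_two hBn (hX1 B hB))
    rw [hBc] at h
    refine h.trans (Finset.card_le_card fun A hA => ?_)
    obtain ⟨hA1, hA2⟩ := Finset.mem_filter.1 hA
    exact (Finset.mem_bipartiteAbove _).2 ⟨Finset.mem_filter.2 ⟨hA1, B, hB, hA2⟩, hA2⟩
  have hbelow : ∀ A ∈ N, (Finset.bipartiteBelow (fun B A : Finset ℕ => Disjoint B A) X A).card ≤
      (n - a).choose c := by
    intro A hA
    obtain ⟨⟨hAn, hAc⟩, hA1⟩ := mem_star.1 (Finset.mem_filter.1 hA).1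
    have hcard : (Finset.Icc 1 n \ A).card = n - a := by
      rw [Finset.card_sdiff_of_subset hAn, Nat.card_Icc, hAc]
      omega
    rw [← hcard, ← Finset.card_powersetCard]
    refine Finset.card_le_card fun B hB => ?_
    obtain ⟨hBX, hBA⟩ := (Finset.mem_bipartiteBelow _).1 hB
    obtain ⟨hBn, hBc⟩ := mem_ksubsets.1 (hX hBX)
    exact Finset.mem_powersetCard.2 ⟨Finset.subset_sdiff.2 ⟨hBn, hBA⟩, hBc⟩
  have hle := Finset.card_mul_le_card_mul _ habove hbelow
  have hchoose : (n - a).choose c ≤ (n - 1 - c).choose (a - 1) := by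
    rw [← Nat.choose_symm (by omega : c ≤ n - a),
      ← Nat.choose_symm (by omega : a - 1 ≤ n - 1 - c),
      show n - 1 - c - (a - 1) = n - a - c by omega]
    exact Nat.choose_le_choose _ (by omega)
  have hpos : 0 < (n - a).choose c := Nat.choose_pos (by omega)
  exact Nat.le_of_mul_le_mul_right ((Nat.mul_le_mul_left _ hchoose).trans hle) hpos

lemma star_subset_of_lInitial {n k : ℕ} {A : Finset (Finset ℕ)} (hA : LInitial n k A)
    {B : Finset ℕ} (hB : B ∈ A) (h1B : 1 ∉ B) : fullStar n k ⊆ A := by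
  obtain ⟨R, hR, rfl⟩ := hA
  obtain ⟨hBk, hBR⟩ := Finset.mem_filter.1 hB
  have hBn := (mem_ksubsets.1 hBk).1
  have hRn := (mem_ksubsets.1 hR).1
  have h1R : 1 ∉ R := by
    intro h1R
    rcases hBR with h | h
    · exact h1B (h h1R)
    · have hmin : (R \ B).min ≤ (1 : ℕ) := Finset.min_le (by simp [h1R, h1B])
      obtain ⟨m, hm⟩ := WithTop.ne_top_iff_exists.1 (h.trans_le hmin).ne_top
      have hmB := hBn (Finset.mem_sdiff.1 (Finset.mem_of_min hm.symm)).1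
      rw [← hm] at h
      have hlt := WithTop.coe_lt_coe.1 (h.trans_le hmin)
      simp only [Finset.mem_Icc] at hmB
      omega
  intro C hC
  obtain ⟨hCk, h1C⟩ := mem_star.1 hC
  refine Finset.mem_filter.2 ⟨mem_ksubsets.2 hCk, Or.inr ?_⟩
  have hmin : (C \ R).min ≤ (1 : ℕ) := Finset.min_le (by simp [h1R, h1C])
  refine hmin.trans_lt ?_
  by_contra! hcon
  obtain ⟨m, hm⟩ := WithTop.ne_top_iff_exists.1 (hcon.trans_lt (WithTop.coe_lt_top 1)).ne
  have hmR := (Finset.mem_sdiff.1 (Finset.mem_of_min hm.symm)).1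
  rw [← hm] at hcon
  have hle : m ≤ 1 := WithTop.coe_le_coe.1 hcon
  have hm1 := hRn hmR
  simp only [Finset.mem_Icc] at hm1
  exact h1R ((by omega : m = 1) ▸ hmR)

lemma inter_nonempty_of_lt_card_add {n : ℕ} {A B : Finset ℕ} (hA : A ⊆ Finset.Icc 1 n)
    (hB : B ⊆ Finset.Icc 1 n) (h : n < A.card + B.card) : (A ∩ B).Nonempty := by
  refine Finset.inter_nonempty_of_card_lt_card_add_card hA hB ?_
  simpa using h

lemma CrossInt.symm {A B : Finset (Finset ℕ)} (h : CrossInt A B) : CrossInt B A :=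
  fun b hb a ha => Finset.inter_comm a b ▸ h a ha b hb

lemma IsCIS.crossInt {n t : ℕ} {k : Fin t → ℕ} {F : Fin t → Finset (Finset ℕ)}
    (h : IsCIS n k F) {i j : Fin t} (hij : i ≠ j) : CrossInt (F i) (F j) := by
  rcases lt_or_gt_of_ne hij with h' | h'
  · exact h.2.2 i j h'
  · exact (h.2.2 j i h').symm

lemma crossInt_star (n k l : ℕ) : CrossInt (fullStar n k) (fullStar n l) :=
  fun _ hA _ hB => ⟨1, Finset.mem_inter.2 ⟨(mem_star.1 hA).2, (mem_star.1 hB).2⟩⟩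

lemma isCIS_star {n t : ℕ} {k : Fin t → ℕ} (hk : ∀ i, 1 ≤ k i) (hkn : ∀ i, k i ≤ n) :
    IsCIS n k fun i => fullStar n (k i) :=
  ⟨fun _ => Finset.filter_subset _ _, fun i => star_nonempty (hk i) (hkn i),
    fun _ _ _ => crossInt_star _ _ _⟩

/-- If some family other than `F i₀` and `F i₁` is not contained in the star, then the system is
strictly smaller than the system of stars. -/
lemma sum_card_lt_sum_card_star {n t : ℕ} {k : Fin t → ℕ} {F : Fin t → Finset (Finset ℕ)}
    (hF : IsCIS n k F) (hLin : ∀ i, LInitial n (k i) (F i)) (hk : ∀ i, 1 ≤ k i)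
    {i₀ i₁ j : Fin t} (h01 : i₀ ≠ i₁) (hj0 : i₀ ≠ j) (hj1 : i₁ ≠ j)
    (hlt : k j < k i₀) (hle : ∀ i, i ≠ j → k i + k j ≤ n)
    {B : Finset ℕ} (hB : B ∈ F j) (h1B : 1 ∉ B) :
    ∑ i, (F i).card < ∑ i, (fullStar n (k i)).card := by
  have hstar : fullStar n (k j) ⊆ F j := star_subset_of_lInitial (hLin j) hB h1B
  have hsub : ∀ i, i ≠ j → F i ⊆ fullStar n (k i) := by
    intro i hij A hA
    have hAk := mem_ksubsets.1 (hF.1 i hA)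
    refine mem_star.2 ⟨hAk, ?_⟩
    by_contra h1A
    obtain ⟨C, hC, hdisj⟩ := exists_mem_star_disjoint (k := k j) (hk j) hAk.1 h1A
      (by rw [hAk.2]; exact hle i hij)
    exact Finset.not_disjoint_iff_nonempty_inter.2 (hF.crossInt hij A hA C (hstar hC)) hdisj
  have hltOne : (F i₁).card < (fullStar n (k i₁)).card := by
    have hBk := mem_ksubsets.1 (hF.1 j hB)
    obtain ⟨C, hC, hdisj⟩ := exists_mem_star_disjoint (k := k i₁) (hk i₁) hBk.1 h1B
      (by rw [hBk.2, add_comm]; exact hle i₁ hj1)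
    refine Finset.card_lt_card (Finset.ssubset_iff_subset_ne.2 ⟨hsub i₁ hj1, fun h => ?_⟩)
    exact Finset.not_disjoint_iff_nonempty_inter.2
      (hF.crossInt hj1.symm B hB C (h ▸ hC)) hdisj
  have hpair : (F j).card + (F i₀).card ≤ (fullStar n (k j)).card + (fullStar n (k i₀)).card := by
    set X := F j \ fullStar n (k j) with hX
    have hXsub : X ⊆ ksubsets n (k j) := Finset.sdiff_subset.trans (hF.1 j)
    have hX1 : ∀ B ∈ X, 1 ∉ B := by
      intro B hB h1
      obtain ⟨hBF, hBs⟩ := Finset.mem_sdiff.1 hB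
      exact hBs (mem_star.2 ⟨mem_ksubsets.1 (hF.1 j hBF), h1⟩)
    have hexcl := card_le_card_star_excluded hlt (hle i₀ hj0) hXsub hX1
    set N := (fullStar n (k i₀)).filter fun A => ∃ B ∈ X, Disjoint B A
    have hN : N ⊆ fullStar n (k i₀) := Finset.filter_subset _ _
    have hFN : F i₀ ⊆ fullStar n (k i₀) \ N := by
      intro A hA
      refine Finset.mem_sdiff.2 ⟨hsub i₀ hj0 hA, fun hAN => ?_⟩
      obtain ⟨-, C, hC, hdisj⟩ := Finset.mem_filter.1 hAN
      exact Finset.not_disjoint_iff_nonempty_inter.2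
        (hF.crossInt hj0.symm C (Finset.mem_sdiff.1 hC).1 A hA) hdisj
    have h1 := Finset.card_le_card hFN
    rw [Finset.card_sdiff_of_subset hN] at h1
    have h2 := Finset.card_sdiff_add_card_eq_card hstar
    rw [← hX] at h2
    have h3 := Finset.card_le_card hN
    omega
  have hmem0 : i₀ ∈ Finset.univ.erase j := by simpa using hj0
  have hrest : ∑ i ∈ (Finset.univ.erase j).erase i₀, (F i).card <
      ∑ i ∈ (Finset.univ.erase j).erase i₀, (fullStar n (k i)).card := by
    refine Finset.sum_lt_sum (fun i hi => Finset.card_le_card (hsub i ?_))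
      ⟨i₁, by simp [hj1, h01.symm], hltOne⟩
    exact (Finset.mem_erase.1 (Finset.mem_erase.1 hi).2).1
  rw [← Finset.add_sum_erase _ _ (Finset.mem_univ j), ← Finset.add_sum_erase _ _ hmem0,
    ← Finset.add_sum_erase _ (fun i => (fullStar n (k i)).card) (Finset.mem_univ j),
    ← Finset.add_sum_erase _ (fun i => (fullStar n (k i)).card) hmem0]
  omega

/-- If in an extremal system all families but two are contained in the star, and the sizes force
those two to be cross intersecting, then each of them has at least the size of the star. -/
lemma Extremal.card_star_le {n t : ℕ} {k : Fin t → ℕ} {F : Fin t → Finset (Finset ℕ)}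
    (hF : Extremal n k F) {i₀ i₁ : Fin t} (hn : n < k i₀ + k i₁)
    (hstar : ∀ j, j ≠ i₀ → j ≠ i₁ → F j ⊆ fullStar n (k j)) :
    (fullStar n (k i₀)).card ≤ (F i₀).card := by
  obtain ⟨hCIS, hmax⟩ := hF
  set G := Function.update F i₀ (F i₀ ∪ fullStar n (k i₀))
  have hG0 : G i₀ = F i₀ ∪ fullStar n (k i₀) := Function.update_self _ _ _
  have hGne : ∀ j, j ≠ i₀ → G j = F j := fun j hj => Function.update_of_ne hj _ _
  have hsub : ∀ i, F i ⊆ G i := by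
    intro i
    by_cases hi : i = i₀
    · subst hi
      exact hG0 ▸ Finset.subset_union_left
    · exact (hGne i hi).symm.subset
  have hGk : ∀ i, G i ⊆ ksubsets n (k i) := by
    intro i
    by_cases hi : i = i₀
    · subst hi
      exact hG0 ▸ Finset.union_subset (hCIS.1 i) (Finset.filter_subset _ _)
    · exact hGne i hi ▸ hCIS.1 i
  have hcross : ∀ j, j ≠ i₀ → CrossInt (G i₀) (G j) := by
    intro j hj A hA B hB
    by_cases hj1 : j = i₁
    · subst hj1
      obtain ⟨hAn, hAc⟩ := mem_ksubsets.1 (hGk i₀ hA)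
      obtain ⟨hBn, hBc⟩ := mem_ksubsets.1 (hGk j hB)
      exact inter_nonempty_of_lt_card_add hAn hBn (by omega)
    · rw [hG0] at hA
      rw [hGne j hj] at hB
      rcases Finset.mem_union.1 hA with hA | hA
      · exact hCIS.crossInt hj.symm A hA B hB
      · exact crossInt_star _ _ _ A hA B (hstar j hj hj1 hB)
  have hGCIS : IsCIS n k G := by
    refine ⟨hGk, fun i => (hCIS.2.1 i).mono (hsub i), fun i j hij => ?_⟩
    by_cases hi : i = i₀
    · subst hi
      exact hcross j hij.ne'
    by_cases hj : j = i₀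
    · subst hj
      exact (hcross i hi).symm
    · rw [hGne i hi, hGne j hj]
      exact hCIS.2.2 i j hij
  have hsum : ∑ i, (F i).card = ∑ i, (G i).card :=
    le_antisymm (Finset.sum_le_sum fun i _ => Finset.card_le_card (hsub i)) (hmax G hGCIS)
  have heq := (Finset.sum_eq_sum_iff_of_le fun i _ => Finset.card_le_card (hsub i)).1 hsum
    i₀ (Finset.mem_univ _)
  rw [heq, hG0]
  exact Finset.card_le_card Finset.subset_union_right

/-- in an extremal L-initial system with `k₁ + k₃ ≤ n < k₁ + k₂`, the first
two families are at least star-sized. -/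
theorem extremal_first_two_large (n t : ℕ) (k : Fin t → ℕ)
    (F : Fin t → Finset (Finset ℕ))
    (ht : 3 ≤ t)
    (hanti : ∀ i j : Fin t, i ≤ j → k j ≤ k i)
    (h12 : k ⟨1, by omega⟩ < k ⟨0, by omega⟩)
    (hkt : 2 ≤ k ⟨t - 1, by omega⟩)
    (hn1 : k ⟨0, by omega⟩ + k ⟨2, by omega⟩ ≤ n)
    (hn2 : n < k ⟨0, by omega⟩ + k ⟨1, by omega⟩)
    (hext : Extremal n k F)
    (hLin : ∀ i, LInitial n (k i) (F i)) :
    Nat.choose (n - 1) (k ⟨0, by omega⟩ - 1) ≤ (F ⟨0, by omega⟩).card ∧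
    Nat.choose (n - 1) (k ⟨1, by omega⟩ - 1) ≤ (F ⟨1, by omega⟩).card := by
  set i₀ : Fin t := ⟨0, by omega⟩ with hi₀
  set i₁ : Fin t := ⟨1, by omega⟩ with hi₁
  set i₂ : Fin t := ⟨2, by omega⟩ with hi₂
  have hk : ∀ i, 2 ≤ k i := fun i =>
    hkt.trans (hanti i _ (Fin.mk_le_mk.2 (by have := i.2; omega)))
  have hk0 : ∀ i, k i ≤ k i₀ := fun i => hanti i₀ i (Fin.mk_le_mk.2 (by omega))
  have hother : ∀ j, j ≠ i₀ → j ≠ i₁ → i₂ ≤ j := by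
    intro j h0 h1
    have h0' : j.val ≠ 0 := fun h => h0 (Fin.ext h)
    have h1' : j.val ≠ 1 := fun h => h1 (Fin.ext h)
    exact Fin.mk_le_mk.2 (by omega)
  have h01 : i₀ ≠ i₁ := by simp [hi₀, hi₁]
  have hk21 : k i₂ ≤ k i₁ := hanti i₁ i₂ (by simp [hi₁, hi₂])
  have hstar : ∀ j, j ≠ i₀ → j ≠ i₁ → F j ⊆ fullStar n (k j) := by
    intro j h0 h1 B hB
    refine mem_star.2 ⟨mem_ksubsets.1 (hext.1.1 j hB), ?_⟩
    by_contra h1B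
    have hj2 := hanti i₂ j (hother j h0 h1)
    have hlt := sum_card_lt_sum_card_star hext.1 hLin (fun i => by have := hk i; omega) h01
      h0.symm h1.symm (by omega) (fun i _ => by have := hk0 i; omega) hB h1B
    exact absurd (hext.2 _ (isCIS_star (fun i => by have := hk i; omega)
      (fun i => by have := hk0 i; omega))) hlt.not_ge
  have hk0' := hk i₀
  have hk1' := hk i₁
  exact ⟨(choose_le_card_star (by omega) (by omega)).trans (hext.card_star_le hn2 hstar),
    (choose_le_card_star (by omega) (by omega)).trans
      (hext.card_star_le (by omega) fun j h1 h0 => hstar j h0 h1)⟩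
end
end
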